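/- arXiv:2507.01041 — 8 statements merged into one kernel-verified Lean document; each statement's English description precedes it below -/
import Mathlib

section
/- Under Assumption 1, the minimum of T_{G′}(C) over all s-t cuts C of the restructured DAG G′ equals the minimum of the training delay T(V_D) over all splittings V_D ⊆ V; in particular, any minimum s-t cut of G′ yields a model splitting of minimum training delay. (Theorem 1.) -/
open Finset

attribute [local instance] Classical.propDecidable

/-- Split-learning delay model: layers `V`, directed edges `E` (child consumes
parent's output), iteration count `N`, transmission rates `RD` (device→server)
and `RS` (server→device), per-layer device/server computation delays `xiD`/`xiS`,
parameter size `k`, and smashed-data size `a`. -/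
structure SLModel (V : Type) where
  E : Finset (V × V)
  N : ℝ
  RD : ℝ
  RS : ℝ
  xiD : V → ℝ
  xiS : V → ℝ
  k : V → ℝ
  a : V → ℝ

/-- The standing hypotheses: positive `N`, `RD`, `RS`, nonnegative per-layer
parameters, and `E` is acyclic (admits a topological ordering). -/
def SLModel.Valid {V : Type} (M : SLModel V) : Prop :=
  0 < M.N ∧ 0 < M.RD ∧ 0 < M.RS ∧ (∀ v, 0 ≤ M.xiD v) ∧ (∀ v, 0 ≤ M.xiS v) ∧
    (∀ v, 0 ≤ M.k v) ∧ (∀ v, 0 ≤ M.a v) ∧ ∃ f : V → ℕ, ∀ e ∈ M.E, f e.1 < f e.2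

/-- Boundary set `V_c` of a splitting `VD`: device layers with a child on the server. -/
noncomputable def SLModel.boundary {V : Type} (M : SLModel V) (VD : Finset V) : Finset V :=
  VD.filter (fun v => ∃ u, (v, u) ∈ M.E ∧ u ∉ VD)

/-- Training delay `T(V_D)` of a splitting. -/
noncomputable def SLModel.T {V : Type} [Fintype V] (M : SLModel V) (VD : Finset V) : ℝ :=
  M.N * ((∑ v ∈ VD, M.xiD v) + (∑ v ∈ M.boundary VD, M.a v / M.RD)
      + (∑ v ∈ Finset.univ \ VD, M.xiS v) + (∑ v ∈ M.boundary VD, M.a v / M.RS))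
    + (∑ v ∈ VD, M.k v / M.RD) + (∑ v ∈ VD, M.k v / M.RS)

/-- Number of children of `v` under `E`. -/
noncomputable def childCount {V : Type} (M : SLModel V) (v : V) : ℕ :=
  (M.E.filter (fun e => e.1 = v)).card

/-- `P`: the set of parent vertices with at least two children. -/
noncomputable def Pset {V : Type} [Fintype V] (M : SLModel V) : Finset V :=
  Finset.univ.filter (fun p => 2 ≤ childCount M p)

/-- Nodes of the restructured DAG `G'`: layer `v`, auxiliary vertex `p'`
(meaningful for `p ∈ P`), source `D`, sink `S`. -/
def layerN {V : Type} (v : V) : V ⊕ V ⊕ Bool := Sum.inl v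

def auxN {V : Type} (p : V) : V ⊕ V ⊕ Bool := Sum.inr (Sum.inl p)

def srcN {V : Type} : V ⊕ V ⊕ Bool := Sum.inr (Sum.inr false)

def snkN {V : Type} : V ⊕ V ⊕ Bool := Sum.inr (Sum.inr true)

/-- Weighted edges of the restructured DAG `G'`: for each `p ∈ P` all edges of
`G` into `p` are redirected into `p'`, the edge `(p, S)` becomes `(p', S)`, and a
new edge `(p', p)` carries `p`'s propagation weight; all other edges of `G` are
kept unchanged.  `wG' M x y` is the weight of the edge `(x, y)` (0 if absent). -/
noncomputable def wG' {V : Type} [Fintype V] (M : SLModel V) :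
    (V ⊕ V ⊕ Bool) → (V ⊕ V ⊕ Bool) → ℝ
  | Sum.inl u, Sum.inl v =>
      if (u, v) ∈ M.E ∧ v ∉ Pset M then M.N * (M.a u / M.RD + M.a u / M.RS) else 0
  | Sum.inl u, Sum.inr (Sum.inl v) =>
      if (u, v) ∈ M.E ∧ v ∈ Pset M then M.N * (M.a u / M.RD + M.a u / M.RS) else 0
  | Sum.inl v, Sum.inr (Sum.inr b) =>
      if b = true ∧ v ∉ Pset M then M.N * M.xiD v + M.k v / M.RD + M.k v / M.RS else 0
  | Sum.inr (Sum.inl p), Sum.inl q =>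
      if p = q ∧ p ∈ Pset M then M.N * (M.a p / M.RD + M.a p / M.RS) else 0
  | Sum.inr (Sum.inl p), Sum.inr (Sum.inr b) =>
      if b = true ∧ p ∈ Pset M then M.N * M.xiD p + M.k p / M.RD + M.k p / M.RS else 0
  | Sum.inr (Sum.inr b), Sum.inl v =>
      if b = false ∧ v ∉ Pset M then M.N * M.xiS v else 0
  | Sum.inr (Sum.inr b), Sum.inr (Sum.inl p) =>
      if b = false ∧ p ∈ Pset M then M.N * M.xiS p else 0
  | _, _ => 0

/-- An s-t cut of `G'`: a vertex set containing `D` and not `S`. -/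
def IsCutG' {V : Type} (C : Finset (V ⊕ V ⊕ Bool)) : Prop :=
  srcN ∈ C ∧ snkN ∉ C

/-- Value `T_{G'}(C)` of a cut: total weight of edges from inside `C` to outside `C`. -/
noncomputable def cutValG' {V : Type} [Fintype V] (M : SLModel V)
    (C : Finset (V ⊕ V ⊕ Bool)) : ℝ :=
  ∑ x : V ⊕ V ⊕ Bool, ∑ y : V ⊕ V ⊕ Bool, if x ∈ C ∧ y ∉ C then wG' M x y else 0

/-- Splitting induced by a cut `C` of `G'`:
`V_D = {v ∈ V∖P : v ∈ C} ∪ {p ∈ P : p' ∈ C}`. -/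
noncomputable def splitOfCut {V : Type} [Fintype V] (M : SLModel V)
    (C : Finset (V ⊕ V ⊕ Bool)) : Finset V :=
  (Finset.univ \ Pset M).filter (fun v => layerN v ∈ C)
    ∪ (Pset M).filter (fun p => auxN p ∈ C)

/-- The propagation weight of the edges leaving layer `v`. -/
noncomputable def SLModel.propW {V : Type} (M : SLModel V) (v : V) : ℝ :=
  M.N * (M.a v / M.RD + M.a v / M.RS)

/-- The execution weight of layer `v` under the splitting `VD`. -/
noncomputable def SLModel.execW {V : Type} (M : SLModel V) (VD : Finset V) (v : V) : ℝ :=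
  if v ∈ VD then M.N * M.xiD v + M.k v / M.RD + M.k v / M.RS else M.N * M.xiS v

theorem SLModel.Valid.propW_nonneg {V : Type} {M : SLModel V} (hM : M.Valid) (v : V) :
    0 ≤ M.propW v := by
  obtain ⟨hN, hRD, hRS, -, -, -, ha, -⟩ := hM
  have := ha v
  unfold SLModel.propW
  positivity

theorem SLModel.T_eq_sum {V : Type} [Fintype V] (M : SLModel V) (VD : Finset V) :
    M.T VD = ∑ v, (M.execW VD v + if v ∈ M.boundary VD then M.propW v else 0) := by
  have hc : Finset.univ \ VD = Finset.univ.filter (· ∉ VD) := by ext; simp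
  simp only [SLModel.T, SLModel.execW, SLModel.propW, hc, sum_add_distrib, sum_ite, sum_const_zero,
    add_zero, filter_univ_mem, mul_add, mul_sum]
  ring

theorem mem_splitOfCut {V : Type} [Fintype V] (M : SLModel V) (C : Finset (V ⊕ V ⊕ Bool)) (v : V) :
    v ∈ splitOfCut M C ↔ if v ∈ Pset M then auxN v ∈ C else layerN v ∈ C := by
  by_cases h : v ∈ Pset M <;> simp [splitOfCut, h]

theorem cutValG'_eq_sum {V : Type} [Fintype V] (M : SLModel V) {C : Finset (V ⊕ V ⊕ Bool)}
    (hC : IsCutG' C) :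
    cutValG' M C = ∑ u, (M.execW (splitOfCut M C) u
      + ((if u ∈ Pset M ∧ auxN u ∈ C ∧ layerN u ∉ C then M.propW u else 0)
      + ∑ v, if (u, v) ∈ M.E ∧ layerN u ∈ C ∧ v ∉ splitOfCut M C then M.propW u else 0)) := by
  obtain ⟨hD, hS⟩ := hC
  let f : (V ⊕ V ⊕ Bool) → (V ⊕ V ⊕ Bool) → ℝ := fun x y =>
    if x ∈ C ∧ y ∉ C then wG' M x y else 0
  have hexec : ∀ u, M.execW (splitOfCut M C) u
      = f (layerN u) snkN + f (auxN u) snkN + f srcN (layerN u) + f srcN (auxN u) := by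
    intro u
    simp only [f, hD, hS, SLModel.execW, mem_splitOfCut]
    simp only [wG', layerN, auxN, srcN, snkN]
    split_ifs <;> simp_all
  have haux : ∀ u, (if u ∈ Pset M ∧ auxN u ∈ C ∧ layerN u ∉ C then M.propW u else 0)
      = ∑ q, f (auxN u) (layerN q) := by
    intro u
    rw [Finset.sum_eq_single u]
    · simp only [f, SLModel.propW, wG', layerN, auxN, true_and, ← ite_and]
      exact if_congr (by tauto) rfl rfl
    · intro q _ hq
      simp [f, wG', layerN, auxN, hq.symm]
    · simp
  have hprop : ∀ u v,
      (if (u, v) ∈ M.E ∧ layerN u ∈ C ∧ v ∉ splitOfCut M C then M.propW u else 0)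
      = f (layerN u) (layerN v) + f (layerN u) (auxN v) := by
    intro u v
    by_cases hv : v ∈ Pset M <;>
      simp only [f, SLModel.propW, mem_splitOfCut, wG', layerN, auxN, hv, not_true_eq_false,
        not_false_eq_true, and_true, and_false, if_true, if_false, add_zero, zero_add,
        ← ite_and] <;>
      exact if_congr (by tauto) rfl rfl
  have hsrc : ∀ x, f x srcN = 0 := fun x => if_neg fun h => h.2 hD
  have hsnk : ∀ y, f snkN y = 0 := fun y => if_neg fun h => hS h.1
  have hauxaux : ∀ p q, f (auxN p) (auxN q) = 0 := fun _ _ => ite_self _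
  have hsrcsnk : f srcN snkN = 0 := ite_self _
  simp only [hexec, haux, hprop]
  change ∑ x, ∑ y, f x y = _
  clear_value f
  simp only [layerN, auxN, srcN, snkN] at hsrc hsnk hauxaux hsrcsnk ⊢
  simp only [Fintype.sum_sum_type, Fintype.sum_bool, hsrc, hsnk, hauxaux, hsrcsnk,
    sum_add_distrib, sum_const_zero, add_zero, zero_add]
  ring

theorem SLModel.Valid.T_splitOfCut_le {V : Type} [Fintype V] {M : SLModel V} (hM : M.Valid)
    {C : Finset (V ⊕ V ⊕ Bool)} (hC : IsCutG' C) : M.T (splitOfCut M C) ≤ cutValG' M C := by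
  rw [M.T_eq_sum, cutValG'_eq_sum M hC]
  gcongr with u
  have hw := hM.propW_nonneg u
  have hterm : ∀ v ∈ Finset.univ, 0 ≤
      if (u, v) ∈ M.E ∧ layerN u ∈ C ∧ v ∉ splitOfCut M C then M.propW u else 0 := by
    intro v _
    split_ifs <;> simp [hw]
  have hsum := Finset.sum_nonneg hterm
  split_ifs with hb hz hz
  · linarith
  · obtain ⟨hu, v, huv, hv⟩ := by simpa [SLModel.boundary] using hb
    have hl : layerN u ∈ C := by
      rw [mem_splitOfCut] at hu
      split_ifs at hu with hp
      · by_contra hl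
        exact hz ⟨hp, hu, hl⟩
      · exact hu
    have := Finset.single_le_sum hterm (Finset.mem_univ v)
    rw [if_pos ⟨huv, hl, hv⟩] at this
    rwa [zero_add]
  · linarith
  · linarith

/-- The cut of `G'` realising a splitting: an auxiliary vertex sits with its layer, and the layer
vertex of a branching layer is on the source side only if its children are all on the device. -/
noncomputable def cutOfSplit {V : Type} [Fintype V] (M : SLModel V) (VD : Finset V) :
    Finset (V ⊕ V ⊕ Bool) :=
  Finset.univ.filter fun x => match x with
    | Sum.inl v => v ∈ VD ∧ (v ∈ Pset M → v ∉ M.boundary VD)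
    | Sum.inr (Sum.inl p) => p ∈ VD
    | Sum.inr (Sum.inr b) => b = false

theorem isCutG'_cutOfSplit {V : Type} [Fintype V] (M : SLModel V) (VD : Finset V) :
    IsCutG' (cutOfSplit M VD) := by
  simp [IsCutG', cutOfSplit, srcN, snkN]

theorem splitOfCut_cutOfSplit {V : Type} [Fintype V] (M : SLModel V) (VD : Finset V) :
    splitOfCut M (cutOfSplit M VD) = VD := by
  ext v
  rw [mem_splitOfCut]
  by_cases h : v ∈ Pset M <;> simp [cutOfSplit, layerN, auxN, h]

theorem eq_of_notMem_Pset {V : Type} [Fintype V] {M : SLModel V} {u v w : V} (hu : u ∉ Pset M)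
    (hv : (u, v) ∈ M.E) (hw : (u, w) ∈ M.E) : v = w := by
  have hcard : (M.E.filter (fun e => e.1 = u)).card ≤ 1 := by
    by_contra! h
    exact hu (mem_filter.2 ⟨mem_univ u, h⟩)
  have := Finset.card_le_one.1 hcard (u, v) (by simp [hv]) (u, w) (by simp [hw])
  simpa using this

theorem cutValG'_cutOfSplit {V : Type} [Fintype V] (M : SLModel V) (VD : Finset V) :
    cutValG' M (cutOfSplit M VD) = M.T VD := by
  rw [M.T_eq_sum, cutValG'_eq_sum M (isCutG'_cutOfSplit M VD), splitOfCut_cutOfSplit]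
  refine Finset.sum_congr rfl fun u _ => congrArg _ ?_
  have hl : layerN u ∈ cutOfSplit M VD ↔ u ∈ VD ∧ (u ∈ Pset M → u ∉ M.boundary VD) := by
    simp [cutOfSplit, layerN]
  have ha : auxN u ∈ cutOfSplit M VD ↔ u ∈ VD := by simp [cutOfSplit, auxN]
  have hb : u ∈ M.boundary VD ↔ u ∈ VD ∧ ∃ v, (u, v) ∈ M.E ∧ v ∉ VD := by
    simp [SLModel.boundary]
  simp only [hl, ha]
  by_cases hub : u ∈ M.boundary VD
  · obtain ⟨hu, v, huv, hv⟩ := hb.1 hub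
    by_cases hp : u ∈ Pset M
    · simp [hp, hub, hu]
    · rw [Finset.sum_eq_single v]
      · simp [hp, hub, hu, huv, hv]
      · intro w _ hwv
        exact if_neg fun h => hwv (eq_of_notMem_Pset hp h.1 huv)
      · simp
  · have hzero : ∀ v ∈ Finset.univ, (if (u, v) ∈ M.E
        ∧ (u ∈ VD ∧ (u ∈ Pset M → u ∉ M.boundary VD)) ∧ v ∉ VD then M.propW u else 0) = 0 :=
      fun v _ => if_neg fun h => hub (hb.2 ⟨h.2.1.1, v, h.1, h.2.2⟩)
    rw [Finset.sum_eq_zero hzero]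
    simp [hub]


/-- **Theorem 1.** Under Assumption 1 (`xiS v ≤ xiD v` for all `v`), the minimum
value of `T_{G'}` over all s-t cuts of `G'` equals the minimum training delay
`T(V_D)` over all splittings; in particular, any minimum s-t cut of `G'` yields
(via `splitOfCut`) a splitting of minimum training delay. -/
theorem min_cut_eq_min_delay {V : Type} [Fintype V] (M : SLModel V) (hM : M.Valid)
    (hAss1 : ∀ v, M.xiS v ≤ M.xiD v) :
    sInf {x : ℝ | ∃ C : Finset (V ⊕ V ⊕ Bool), IsCutG' C ∧ x = cutValG' M C}
        = sInf {x : ℝ | ∃ VD : Finset V, x = M.T VD}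
    ∧ ∀ C : Finset (V ⊕ V ⊕ Bool), IsCutG' C →
        (∀ C' : Finset (V ⊕ V ⊕ Bool), IsCutG' C' → cutValG' M C ≤ cutValG' M C') →
        ∀ VD : Finset V, M.T (splitOfCut M C) ≤ M.T VD := by
  refine ⟨?_, fun C hC hmin VD => ?_⟩
  · have hfin : ({x : ℝ | ∃ VD : Finset V, x = M.T VD}).Finite :=
      (Set.finite_range M.T).subset (by rintro _ ⟨VD, rfl⟩; exact ⟨VD, rfl⟩)
    have hbdd : BddBelow {x : ℝ | ∃ C : Finset (V ⊕ V ⊕ Bool), IsCutG' C ∧ x = cutValG' M C} :=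
      ((Set.finite_range (cutValG' M)).subset
        (by rintro _ ⟨C, _, rfl⟩; exact ⟨C, rfl⟩)).bddBelow
    apply le_antisymm
    · refine le_csInf ⟨_, ∅, rfl⟩ ?_
      rintro _ ⟨VD, rfl⟩
      exact csInf_le hbdd ⟨_, isCutG'_cutOfSplit M VD, (cutValG'_cutOfSplit M VD).symm⟩
    · refine le_csInf ⟨_, _, isCutG'_cutOfSplit M ∅, rfl⟩ ?_
      rintro _ ⟨C, hC, rfl⟩
      exact (csInf_le hfin.bddBelow ⟨_, rfl⟩).trans (hM.T_splitOfCut_le hC)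
  · calc M.T (splitOfCut M C) ≤ cutValG' M C := hM.T_splitOfCut_le hC
      _ ≤ cutValG' M (cutOfSplit M VD) := hmin _ (isCutG'_cutOfSplit M VD)
      _ = M.T VD := cutValG'_cutOfSplit M VD
end

section
/- For every splitting V_D ⊆ V, the s-t cut C = {D} ∪ V_D of the original DAG G satisfies the overcounting identity T_G(C) = T(V_D) + N·Σ_{v ∈ V_D with at least one child in V_S} (d(v) − 1)·(a(v)/R_D + a(v)/R_S), where d(v) denotes the number of children of v lying in V_S. In particular T_G(C) ≥ T(V_D), and if a(v) > 0 for all v ∈ V then equality holds if and only if every v ∈ V_D has at most one child in V_S. (This is the paper's claim that in a nonlinear model the original DAG's cut value overestimates the training delay by counting a parent's propagation weight once per crossed outgoing edge.) -/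
open Finset

attribute [local instance] Classical.propDecidable

/-- Weighted edges of the original DAG `G`: nodes are layers (`Sum.inl v`),
the virtual device/source `D = Sum.inr false`, and the virtual server/sink
`S = Sum.inr true`.  `wG M x y` is the weight of the edge `(x, y)` (0 if absent). -/
noncomputable def wG {V : Type} (M : SLModel V) : V ⊕ Bool → V ⊕ Bool → ℝ
  | Sum.inl u, Sum.inl v =>
      if (u, v) ∈ M.E then M.N * (M.a u / M.RD + M.a u / M.RS) else 0
  | Sum.inl v, Sum.inr b =>
      if b = true then M.N * M.xiD v + M.k v / M.RD + M.k v / M.RS else 0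
  | Sum.inr b, Sum.inl v =>
      if b = false then M.N * M.xiS v else 0
  | Sum.inr _, Sum.inr _ => 0

/-- An s-t cut of `G`: a vertex set containing `D` and not `S`. -/
def IsCutG {V : Type} (C : Finset (V ⊕ Bool)) : Prop :=
  Sum.inr false ∈ C ∧ Sum.inr true ∉ C

/-- Value `T_G(C)` of a cut: total weight of edges from inside `C` to outside `C`. -/
noncomputable def cutValG {V : Type} [Fintype V] (M : SLModel V) (C : Finset (V ⊕ Bool)) : ℝ :=
  ∑ x : V ⊕ Bool, ∑ y : V ⊕ Bool, if x ∈ C ∧ y ∉ C then wG M x y else 0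

/-- `d(v)`: number of children of `v` lying on the server side `V_S = V ∖ V_D`. -/
noncomputable def dS {V : Type} (M : SLModel V) (VD : Finset V) (v : V) : ℕ :=
  (M.E.filter (fun e => e.1 = v ∧ e.2 ∉ VD)).card

/-- Cut of `G` associated to a splitting `V_D`: `C = {D} ∪ V_D`. -/
noncomputable def cutOfSplitG {V : Type} (VD : Finset V) : Finset (V ⊕ Bool) :=
  {(Sum.inr false : V ⊕ Bool)} ∪ VD.image Sum.inl

theorem SLModel.card_server_children {V : Type} [Fintype V] (M : SLModel V) (VD : Finset V)
    (v : V) : (univ.filter (fun u => (v, u) ∈ M.E ∧ u ∉ VD)).card = dS M VD v := by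
  unfold dS
  refine Finset.card_bij (fun u _ => (v, u)) ?_ ?_ ?_
  · simp
  · simp
  · rintro ⟨x, u⟩ h
    simp only [mem_filter] at h
    obtain ⟨h, rfl, hu⟩ := h
    exact ⟨u, by simpa using ⟨h, hu⟩, rfl⟩

theorem SLModel.mem_boundary {V : Type} (M : SLModel V) (VD : Finset V) (v : V) :
    v ∈ M.boundary VD ↔ v ∈ VD ∧ ∃ u, (v, u) ∈ M.E ∧ u ∉ VD :=
  Finset.mem_filter

theorem SLModel.boundary_eq_filter_dS {V : Type} [Fintype V] (M : SLModel V) (VD : Finset V) :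
    M.boundary VD = VD.filter (fun v => 1 ≤ dS M VD v) := by
  ext v
  rw [M.mem_boundary, mem_filter, ← M.card_server_children,
    Nat.one_le_iff_ne_zero, Finset.card_ne_zero]
  simp [Finset.Nonempty]

theorem sum_filter_one_le_natCast_mul {V : Type} (s : Finset V) (d : V → ℕ) (w : V → ℝ) :
    ∑ v ∈ s, (d v : ℝ) * w v = ∑ v ∈ s.filter (fun v => 1 ≤ d v), (d v : ℝ) * w v := by
  refine (Finset.sum_filter_of_ne fun v _ h => ?_).symm
  exact Nat.one_le_iff_ne_zero.2 fun h0 => h (by simp [h0])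

/-- The cut value splits into device execution, server execution, and one propagation weight for
each crossed edge. -/
theorem cutValG_cutOfSplitG {V : Type} [Fintype V] (M : SLModel V) (VD : Finset V) :
    cutValG M (cutOfSplitG VD)
      = ∑ v ∈ VD, (M.N * M.xiD v + M.k v / M.RD + M.k v / M.RS)
        + ∑ v ∈ univ \ VD, M.N * M.xiS v
        + ∑ v ∈ VD, (dS M VD v : ℝ) * (M.N * (M.a v / M.RD + M.a v / M.RS)) := by
  have hcross (v : V) :
      (∑ u, if u ∉ VD then
          (if (v, u) ∈ M.E then M.N * (M.a v / M.RD + M.a v / M.RS) else 0) else 0)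
        = (dS M VD v : ℝ) * (M.N * (M.a v / M.RD + M.a v / M.RS)) := by
    rw [← M.card_server_children, ← nsmul_eq_mul, ← Finset.sum_const, Finset.sum_filter]
    refine Finset.sum_congr rfl fun u _ => ?_
    by_cases hu : u ∈ VD <;> simp [hu]
  have hinl (v : V) : (Sum.inl v : V ⊕ Bool) ∈ cutOfSplitG VD ↔ v ∈ VD := by
    simp [cutOfSplitG]
  have hD : (Sum.inr false : V ⊕ Bool) ∈ cutOfSplitG VD := by simp [cutOfSplitG]
  have hS : (Sum.inr true : V ⊕ Bool) ∉ cutOfSplitG VD := by simp [cutOfSplitG]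
  have hrow (v : V) :
      (∑ y : V ⊕ Bool, if (Sum.inl v : V ⊕ Bool) ∈ cutOfSplitG VD ∧ y ∉ cutOfSplitG VD
          then wG M (Sum.inl v) y else 0)
        = if v ∈ VD then (dS M VD v : ℝ) * (M.N * (M.a v / M.RD + M.a v / M.RS))
            + (M.N * M.xiD v + M.k v / M.RD + M.k v / M.RS) else 0 := by
    by_cases hv : v ∈ VD
    · rw [← hcross]
      simp [Fintype.sum_sum_type, hinl, hD, hS, hv, wG]
    · simp [hinl, hv]
  have hsource :
      (∑ y : V ⊕ Bool, if (Sum.inr false : V ⊕ Bool) ∈ cutOfSplitG VD ∧ y ∉ cutOfSplitG VD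
          then wG M (Sum.inr false) y else 0) = ∑ v ∈ univ \ VD, M.N * M.xiS v := by
    have hs : univ \ VD = univ.filter (fun v => v ∉ VD) := by ext; simp
    rw [hs, Finset.sum_filter]
    simp [Fintype.sum_sum_type, hinl, hD, wG]
  unfold cutValG
  rw [Fintype.sum_sum_type, Fintype.sum_bool, hsource]
  simp_rw [hrow]
  rw [← Finset.sum_filter, Finset.filter_mem_eq_inter, Finset.univ_inter, Finset.sum_add_distrib]
  simp only [hS, false_and, if_false, Finset.sum_const_zero]
  ring

/-- **Overcounting identity for the original DAG `G`.** For every splitting `V_D`,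
the s-t cut `C = {D} ∪ V_D` of `G` satisfies
`T_G(C) = T(V_D) + N·Σ_{v ∈ V_D, d(v) ≥ 1} (d(v) − 1)·(a(v)/R_D + a(v)/R_S)`;
in particular `T_G(C) ≥ T(V_D)`, and if `a(v) > 0` for all `v` then equality
holds iff every `v ∈ V_D` has at most one child in `V_S`. -/
theorem original_dag_overcounting {V : Type} [Fintype V] (M : SLModel V) (hM : M.Valid) :
    ∀ VD : Finset V,
      (cutValG M (cutOfSplitG VD)
        = M.T VD + M.N * ∑ v ∈ VD.filter (fun v => 1 ≤ dS M VD v),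
            ((dS M VD v : ℝ) - 1) * (M.a v / M.RD + M.a v / M.RS))
      ∧ M.T VD ≤ cutValG M (cutOfSplitG VD)
      ∧ ((∀ v, 0 < M.a v) →
          (cutValG M (cutOfSplitG VD) = M.T VD ↔ ∀ v ∈ VD, dS M VD v ≤ 1)) := by
  obtain ⟨hN, hRD, hRS, -, -, -, ha, -⟩ := hM
  intro VD
  have hid : cutValG M (cutOfSplitG VD)
      = M.T VD + M.N * ∑ v ∈ VD.filter (fun v => 1 ≤ dS M VD v),
          ((dS M VD v : ℝ) - 1) * (M.a v / M.RD + M.a v / M.RS) := by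
    rw [cutValG_cutOfSplitG, sum_filter_one_le_natCast_mul, SLModel.T, M.boundary_eq_filter_dS]
    simp only [sub_mul, one_mul, mul_left_comm _ M.N, Finset.sum_sub_distrib,
      Finset.sum_add_distrib, ← Finset.mul_sum]
    ring
  have hterm : ∀ v ∈ VD.filter (fun v => 1 ≤ dS M VD v),
      0 ≤ ((dS M VD v : ℝ) - 1) * (M.a v / M.RD + M.a v / M.RS) := by
    intro v hv
    have hd : (1 : ℝ) ≤ dS M VD v := by exact_mod_cast (Finset.mem_filter.1 hv).2
    exact mul_nonneg (sub_nonneg.2 hd)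
      (add_nonneg (div_nonneg (ha v) hRD.le) (div_nonneg (ha v) hRS.le))
  refine ⟨hid, ?_, fun hpos => ?_⟩
  · rw [hid]
    exact le_add_of_nonneg_right (mul_nonneg hN.le (Finset.sum_nonneg hterm))
  · rw [hid, add_eq_left, mul_eq_zero, or_iff_right hN.ne', Finset.sum_eq_zero_iff_of_nonneg hterm]
    refine ⟨fun h v hv => ?_, fun h v hv => ?_⟩
    · by_contra! hd
      have hw : M.a v / M.RD + M.a v / M.RS ≠ 0 :=
        (add_pos (div_pos (hpos v) hRD) (div_pos (hpos v) hRS)).ne'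
      have h1 := (mul_eq_zero.1 (h v (Finset.mem_filter.2 ⟨hv, hd.le⟩))).resolve_right hw
      have h2 : (1 : ℝ) < dS M VD v := by exact_mod_cast hd
      linarith
    · obtain ⟨hv, hd⟩ := Finset.mem_filter.1 hv
      simp [le_antisymm (h v hv) hd]
end

section
/- For every s-t cut C of the original DAG G, the induced splitting V_D = C ∩ V satisfies T(V_D) ≤ T_G(C). Consequently the minimum training delay over all splittings is at most the minimum s-t cut value of G. -/
open Finset

attribute [local instance] Classical.propDecidable

lemma cutValG_eq {V : Type} [Fintype V] (M : SLModel V) {C : Finset (V ⊕ Bool)}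
    (hC : IsCutG C) :
    cutValG M C = (∑ u : V, ∑ v : V, if (Sum.inl u : V ⊕ Bool) ∈ C ∧ (Sum.inl v : V ⊕ Bool) ∉ C
        then wG M (Sum.inl u) (Sum.inl v) else 0)
      + (∑ v : V, if (Sum.inl v : V ⊕ Bool) ∈ C
          then M.N * M.xiD v + M.k v / M.RD + M.k v / M.RS else 0)
      + ∑ v : V, if (Sum.inl v : V ⊕ Bool) ∉ C then M.N * M.xiS v else 0 := by
  obtain ⟨hD, hS⟩ := hC
  simp only [cutValG, Fintype.sum_sum_type, Fintype.sum_bool, Finset.sum_add_distrib]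
  simp [hD, hS, wG, add_assoc]
  exact add_comm _ _

lemma SLModel.T_eq {V : Type} [Fintype V] (M : SLModel V) (VD : Finset V) :
    M.T VD = (∑ v ∈ M.boundary VD, M.N * (M.a v / M.RD + M.a v / M.RS))
      + (∑ v ∈ VD, (M.N * M.xiD v + M.k v / M.RD + M.k v / M.RS))
      + ∑ v ∈ Finset.univ \ VD, M.N * M.xiS v := by
  simp only [SLModel.T, Finset.sum_add_distrib, ← Finset.mul_sum]
  ring

lemma wG_inl_inl_nonneg {V : Type} {M : SLModel V} (hM : M.Valid) (u v : V) :
    0 ≤ wG M (Sum.inl u) (Sum.inl v) := by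
  obtain ⟨hN, hRD, hRS, -, -, -, ha, -⟩ := hM
  have := ha u
  simp only [wG]
  split_ifs <;> positivity

lemma SLModel.Valid.T_le_cutValG {V : Type} [Fintype V] {M : SLModel V} (hM : M.Valid)
    {C : Finset (V ⊕ Bool)} (hC : IsCutG C) :
    M.T (Finset.univ.filter (fun v => (Sum.inl v : V ⊕ Bool) ∈ C)) ≤ cutValG M C := by
  have crossing_nonneg : ∀ u v : V,
      0 ≤ if (Sum.inl u : V ⊕ Bool) ∈ C ∧ (Sum.inl v : V ⊕ Bool) ∉ C
        then wG M (Sum.inl u) (Sum.inl v) else 0 := fun u v => by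
    split_ifs
    exacts [wG_inl_inl_nonneg hM u v, le_rfl]
  rw [cutValG_eq M hC, M.T_eq]
  refine add_le_add (add_le_add ?_ (Finset.sum_filter _ _).le) ?_
  · refine (Finset.sum_le_sum fun u hu => ?_).trans
      (Finset.sum_le_univ_sum_of_nonneg
        fun u => Finset.sum_nonneg fun v _ => crossing_nonneg u v)
    simp only [SLModel.boundary, Finset.mem_filter, Finset.mem_univ, true_and] at hu
    obtain ⟨hu, v, huv, hv⟩ := hu
    refine le_trans (le_of_eq ?_)
      (Finset.single_le_sum (fun v _ => crossing_nonneg u v) (Finset.mem_univ v))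
    simp [hu, hv, huv, wG]
  · rw [← Finset.compl_eq_univ_sdiff, Finset.compl_filter, Finset.sum_filter]

/-- For every s-t cut `C` of the original DAG `G`, the induced splitting
`V_D = C ∩ V` satisfies `T(V_D) ≤ T_G(C)`; consequently the minimum training
delay over all splittings is at most the minimum s-t cut value of `G`. -/
theorem original_dag_lower_bound {V : Type} [Fintype V] (M : SLModel V) (hM : M.Valid) :
    (∀ C : Finset (V ⊕ Bool), IsCutG C →
        M.T (Finset.univ.filter (fun v => (Sum.inl v : V ⊕ Bool) ∈ C)) ≤ cutValG M C)
    ∧ sInf {x : ℝ | ∃ VD : Finset V, x = M.T VD}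
        ≤ sInf {x : ℝ | ∃ C : Finset (V ⊕ Bool), IsCutG C ∧ x = cutValG M C} := by
  refine ⟨fun C hC => hM.T_le_cutValG hC, le_csInf ⟨_, {Sum.inr false}, by simp [IsCutG], rfl⟩ ?_⟩
  rintro _ ⟨C, hC, rfl⟩
  refine le_trans (csInf_le ?_ ⟨_, rfl⟩) (hM.T_le_cutValG hC)
  refine ((Set.finite_range M.T).subset ?_).bddBelow
  rintro _ ⟨VD, rfl⟩
  exact ⟨VD, rfl⟩
end

section
/- Let V_D ⊆ V be a splitting and let v ∈ V_D be a layer such that: v has at least one child, every child of v lies in V_S, and every parent of v that lies in V_D has a child other than v lying in V_S. Then T(V_D) − T(V_D ∖ {v}) = N·(ξ_D(v) − ξ_S(v) + a(v)/R_D + a(v)/R_S) + k(v)/R_D + k(v)/R_S. In particular, if ξ_D(v) ≥ ξ_S(v) and a(v) > 0, then T(V_D ∖ {v}) < T(V_D), so V_D is not a minimum-delay splitting. (This generalizes Eq. (14), the 'case 2' step in the proof of Theorem 1: a cut intersecting only some of the outgoing edges of a parent vertex cannot be optimal.) -/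
open Finset

attribute [local instance] Classical.propDecidable

/-- Moving a boundary layer `v` to the server removes exactly `v` from the boundary, provided
every device parent of `v` keeps another child on the server. -/
theorem SLModel.boundary_erase {V : Type} (M : SLModel V) (VD : Finset V) (v : V)
    (hpar : ∀ p ∈ VD, (p, v) ∈ M.E → ∃ u, u ≠ v ∧ (p, u) ∈ M.E ∧ u ∉ VD) :
    M.boundary (VD.erase v) = (M.boundary VD).erase v := by
  ext w
  simp only [SLModel.boundary, mem_filter, mem_erase]
  constructor
  · rintro ⟨⟨hwv, hw⟩, u, hu, hu'⟩
    refine ⟨hwv, hw, ?_⟩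
    by_cases huv : u = v
    · subst huv
      obtain ⟨u', -, h⟩ := hpar w hw hu
      exact ⟨u', h⟩
    · exact ⟨u, hu, fun h => hu' ⟨huv, h⟩⟩
  · rintro ⟨hwv, hw, u, hu, hu'⟩
    exact ⟨⟨hwv, hw⟩, u, hu, fun h => hu' h.2⟩

/-- **Case-2 step (generalizing Eq. (14)).** Let `v ∈ V_D` have at least one
child, all of its children in `V_S`, and suppose every parent of `v` lying in
`V_D` has a child other than `v` in `V_S`.  Then
`T(V_D) − T(V_D ∖ {v}) = N·(ξ_D(v) − ξ_S(v) + a(v)/R_D + a(v)/R_S) + k(v)/R_D + k(v)/R_S`;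
in particular, if `ξ_D(v) ≥ ξ_S(v)` and `a(v) > 0` then `T(V_D ∖ {v}) < T(V_D)`,
so `V_D` is not a minimum-delay splitting. -/
theorem case2_not_optimal {V : Type} [Fintype V] (M : SLModel V) (hM : M.Valid)
    (VD : Finset V) (v : V) (hv : v ∈ VD)
    (hchild : ∃ u, (v, u) ∈ M.E)
    (hallS : ∀ u, (v, u) ∈ M.E → u ∉ VD)
    (hpar : ∀ p ∈ VD, (p, v) ∈ M.E → ∃ u, u ≠ v ∧ (p, u) ∈ M.E ∧ u ∉ VD) :
    M.T VD - M.T (VD.erase v)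
        = M.N * (M.xiD v - M.xiS v + M.a v / M.RD + M.a v / M.RS)
          + M.k v / M.RD + M.k v / M.RS
    ∧ (M.xiS v ≤ M.xiD v → 0 < M.a v →
        M.T (VD.erase v) < M.T VD ∧ ¬ ∀ VD' : Finset V, M.T VD ≤ M.T VD') := by
  obtain ⟨hN, hRD, hRS, -, -, hk, -, -⟩ := hM
  have hvb : v ∈ M.boundary VD := by
    obtain ⟨u, hu⟩ := hchild
    simp only [SLModel.boundary, mem_filter]
    exact ⟨hv, u, hu, hallS u hu⟩
  have hS : ∑ w ∈ univ \ VD.erase v, M.xiS w = M.xiS v + ∑ w ∈ univ \ VD, M.xiS w := by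
    have hset : univ \ VD.erase v = insert v (univ \ VD) := by
      ext w
      by_cases hw : w = v <;> simp [hw]
    rw [hset, sum_insert (by simp [hv])]
  have hdiff : M.T VD - M.T (VD.erase v)
      = M.N * (M.xiD v - M.xiS v + M.a v / M.RD + M.a v / M.RS)
        + M.k v / M.RD + M.k v / M.RS := by
    simp only [SLModel.T, M.boundary_erase VD v hpar, hS, sum_erase_eq_sub hv,
      sum_erase_eq_sub hvb]
    ring
  refine ⟨hdiff, fun hxi ha => ?_⟩
  have hlt : M.T (VD.erase v) < M.T VD := by
    have hpos : 0 < M.N * (M.xiD v - M.xiS v + M.a v / M.RD + M.a v / M.RS) := by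
      have := div_pos ha hRD
      have := div_pos ha hRS
      exact mul_pos hN (by linarith)
    have := div_nonneg (hk v) hRD.le
    have := div_nonneg (hk v) hRS.le
    linarith
  exact ⟨hlt, fun h => (h (VD.erase v)).not_gt hlt⟩
end

section
/- Let p ∈ P have exactly m children under E, with m ≥ 2, and let C be an s-t cut of G′ such that p ∈ C, p′ ∈ C, and none of the heads of the m outgoing propagation edges of p in G′ lies in C (for a child c, that head is c if c ∉ P and the auxiliary vertex c′ if c ∈ P). Then T_{G′}(C) − T_{G′}(C ∖ {p}) = (m − 1)·N·(a(p)/R_D + a(p)/R_S). In particular, if a(p) > 0 then C is not a minimum s-t cut of G′: the 'case 1' cuts that cross all outgoing edges of a parent vertex are strictly dominated by the corresponding cut through the auxiliary edge (p′, p). -/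
open Finset

attribute [local instance] Classical.propDecidable

/-- Moving a loopless vertex `z` of `C` to the sink side saves the weight of the edges from `z`
to the outside of `C` and adds the weight of the edges from `C` to `z`. -/
theorem cutValG'_sub_cutValG'_erase {V : Type} [Fintype V] (M : SLModel V)
    (C : Finset (V ⊕ V ⊕ Bool)) (z : V ⊕ V ⊕ Bool) (hz : z ∈ C) (hloop : wG' M z z = 0) :
    cutValG' M C - cutValG' M (C.erase z)
      = (∑ y, if y ∉ C then wG' M z y else 0) - ∑ x, if x ∈ C then wG' M x z else 0 := by
  have hterm : ∀ x y,
      (if x ∈ C ∧ y ∉ C then wG' M x y else 0)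
          - (if x ∈ C.erase z ∧ y ∉ C.erase z then wG' M x y else 0)
        = (if x = z then (if y ∉ C then wG' M z y else 0) else 0)
          - (if y = z then (if x ∈ C then wG' M x z else 0) else 0) := by
    intro x y
    by_cases hx : x = z <;> by_cases hy : y = z <;> simp_all
  unfold cutValG'
  simp only [← Finset.sum_sub_distrib, hterm]
  simp [Finset.sum_sub_distrib, Finset.sum_ite_irrel]

/-- The number of children of `p`, as a sum of indicators over all vertices. -/
theorem card_filter_children {V : Type} [Fintype V] (M : SLModel V) (p : V) :
    (Finset.univ.filter (fun c => (p, c) ∈ M.E)).card = childCount M p := by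
  unfold childCount
  refine Finset.card_bij (fun c _ => (p, c)) (by simp) (by simp) ?_
  rintro ⟨u, c⟩ h
  simp only [Finset.mem_filter] at h
  obtain ⟨h, rfl⟩ := h
  exact ⟨c, by simpa using h, rfl⟩

/-- If no head of an edge leaving `p ∈ P` lies in `C`, then every child of `p` contributes the
propagation weight of `p`. -/
theorem sum_out_layerN {V : Type} [Fintype V] (M : SLModel V) (p : V) (hp : p ∈ Pset M)
    (C : Finset (V ⊕ V ⊕ Bool))
    (hheads : ∀ c, (p, c) ∈ M.E →
        (if c ∈ Pset M then (auxN c : V ⊕ V ⊕ Bool) else layerN c) ∉ C) :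
    (∑ y, if y ∉ C then wG' M (layerN p) y else 0)
      = childCount M p * (M.N * (M.a p / M.RD + M.a p / M.RS)) := by
  have hchild : ∀ c, (if layerN c ∉ C then wG' M (layerN p) (layerN c) else 0)
      + (if auxN c ∉ C then wG' M (layerN p) (auxN c) else 0)
      = if (p, c) ∈ M.E then M.N * (M.a p / M.RD + M.a p / M.RS) else 0 := by
    intro c
    have h := hheads c
    by_cases hE : (p, c) ∈ M.E <;> by_cases hc : c ∈ Pset M <;>
      simp_all [wG', layerN, auxN]
  rw [← card_filter_children, ← nsmul_eq_mul, ← Finset.sum_const, Finset.sum_filter,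
    ← Finset.sum_congr rfl (fun c _ => hchild c), Finset.sum_add_distrib,
    Fintype.sum_sum_type, Fintype.sum_sum_type, ← add_assoc]
  refine add_eq_left.2 ?_
  simp [wG', layerN, hp]

/-- The only edge of `G'` into `p ∈ P` is the auxiliary edge `(p', p)`. -/
theorem sum_in_layerN {V : Type} [Fintype V] (M : SLModel V) (p : V) (hp : p ∈ Pset M)
    (C : Finset (V ⊕ V ⊕ Bool)) (hp'C : auxN p ∈ C) :
    (∑ x, if x ∈ C then wG' M x (layerN p) else 0)
      = M.N * (M.a p / M.RD + M.a p / M.RS) := by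
  rw [Finset.sum_eq_single (auxN p)]
  · rw [if_pos hp'C]
    simp [wG', layerN, auxN, hp]
  · rintro (u | q | b) _ hne
    · simp [wG', layerN, hp]
    · have hq : q ≠ p := fun h => hne (h ▸ rfl)
      simp [wG', layerN, hq]
    · simp [wG', layerN, hp]
  · simp

/-- **Case-1 step for `G'`.** Let `p` have exactly `m ≥ 2` children, and let `C`
be an s-t cut of `G'` with `p ∈ C`, `p' ∈ C`, and no head of the `m` outgoing
propagation edges of `p` in `G'` (the head of the edge towards a child `c` is
`c'` if `c ∈ P`, otherwise `c`) lying in `C`.  Then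
`T_{G'}(C) − T_{G'}(C ∖ {p}) = (m − 1)·N·(a(p)/R_D + a(p)/R_S)`;
in particular if `a(p) > 0` then `C` is not a minimum s-t cut of `G'`. -/
theorem case1_cut_dominated {V : Type} [Fintype V] (M : SLModel V) (hM : M.Valid)
    (p : V) (m : ℕ) (hm : 2 ≤ m) (hcp : childCount M p = m)
    (C : Finset (V ⊕ V ⊕ Bool)) (hC : IsCutG' C)
    (hpC : layerN p ∈ C) (hp'C : auxN p ∈ C)
    (hheads : ∀ c, (p, c) ∈ M.E →
        (if c ∈ Pset M then (auxN c : V ⊕ V ⊕ Bool) else layerN c) ∉ C) :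
    cutValG' M C - cutValG' M (C.erase (layerN p))
        = ((m : ℝ) - 1) * M.N * (M.a p / M.RD + M.a p / M.RS)
    ∧ (0 < M.a p →
        ¬ ∀ C' : Finset (V ⊕ V ⊕ Bool), IsCutG' C' → cutValG' M C ≤ cutValG' M C') := by
  have hp : p ∈ Pset M := by simp [Pset, hcp, hm]
  have hdiff : cutValG' M C - cutValG' M (C.erase (layerN p))
      = ((m : ℝ) - 1) * M.N * (M.a p / M.RD + M.a p / M.RS) := by
    rw [cutValG'_sub_cutValG'_erase M C _ hpC (by simp [wG', layerN, hp]),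
      sum_out_layerN M p hp C hheads, sum_in_layerN M p hp C hp'C, hcp]
    ring
  refine ⟨hdiff, fun ha hmin => ?_⟩
  have hcut : IsCutG' (C.erase (layerN p)) :=
    ⟨Finset.mem_erase.mpr ⟨by simp [srcN, layerN], hC.1⟩,
      fun h => hC.2 (Finset.mem_of_mem_erase h)⟩
  have hle := hmin _ hcut
  obtain ⟨hN, hRD, hRS, -⟩ := hM
  have hm' : (0 : ℝ) < (m : ℝ) - 1 := by
    have : (2 : ℝ) ≤ m := by exact_mod_cast hm
    linarith
  have hpos : 0 < ((m : ℝ) - 1) * M.N * (M.a p / M.RD + M.a p / M.RS) := by positivity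
  linarith
end

section
/- Let p ∈ P have exactly m children under E, with m ≥ 2, and let u be a child of p with u ∉ P (so u has at most one child) that has exactly one child. Consider the s-t cuts C₁ = {D, p′} and C₂ = {D, p′, p, u} of G′ (all other vertices of G′ lie outside both cuts). Then T_{G′}(C₂) − T_{G′}(C₁) = (m − 2)·N·(a(p)/R_D + a(p)/R_S) + N·(ξ_D(u) − ξ_S(u)) + N·(a(u)/R_D + a(u)/R_S) + k(u)/R_D + k(u)/R_S. In particular, under Assumption 1, if a(u) > 0 then T_{G′}(C₂) > T_{G′}(C₁), so C₂ is not a minimum s-t cut of G′. (This generalizes Eq. (15), the 'case 2' step in the DAG G′ in the proof of Theorem 1.) -/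
open Finset

attribute [local instance] Classical.propDecidable

/-- Adding a loopless vertex `x` to a cut adds all edges leaving `x` and removes the edges
joining `x` to the cut, in either direction. -/
lemma cutValG'_insert {V : Type} [Fintype V] (M : SLModel V) (C : Finset (V ⊕ V ⊕ Bool))
    (x : V ⊕ V ⊕ Bool) (hx : x ∉ C) (hxx : wG' M x x = 0) :
    cutValG' M (insert x C)
      = cutValG' M C + ∑ y, wG' M x y - ∑ z ∈ C, (wG' M x z + wG' M z x) := by
  have cut_eq (B : Finset (V ⊕ V ⊕ Bool)) :
      cutValG' M B = ∑ z ∈ B, (∑ y, wG' M z y - ∑ y ∈ B, wG' M z y) := by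
    rw [cutValG', ← Finset.sum_filter_add_sum_filter_not univ (· ∈ B)]
    rw [Finset.sum_eq_zero (s := univ.filter (· ∉ B)) (by simp +contextual), add_zero,
      Finset.filter_mem_eq_inter, Finset.univ_inter]
    refine Finset.sum_congr rfl fun z hz => ?_
    simp only [hz, true_and]
    rw [eq_sub_iff_add_eq, ← Finset.sum_filter,
      ← Finset.sum_filter_add_sum_filter_not univ (· ∈ B) (wG' M z),
      Finset.filter_mem_eq_inter, Finset.univ_inter, add_comm]
  rw [cut_eq, cut_eq, Finset.sum_insert hx]
  simp only [Finset.sum_insert hx, hxx, Finset.sum_sub_distrib, Finset.sum_add_distrib]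
  ring

/-- Total weight of the edges of `G'` leaving a layer vertex. -/
lemma sum_wG'_layerN {V : Type} [Fintype V] (M : SLModel V) (v : V) :
    ∑ y, wG' M (layerN v) y
      = childCount M v * (M.N * (M.a v / M.RD + M.a v / M.RS))
        + if v ∈ Pset M then 0 else M.N * M.xiD v + M.k v / M.RD + M.k v / M.RS := by
  have hcount : childCount M v = (univ.filter (fun w => (v, w) ∈ M.E)).card := by
    rw [childCount]
    refine Finset.card_bij' (fun e _ => e.2) (fun w _ => (v, w)) ?_ ?_ ?_ ?_ <;>
      simp +contextual [Prod.ext_iff]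
    rintro a b h rfl
    exact h
  have hchildren : ∑ w : V, ((if (v, w) ∈ M.E ∧ w ∉ Pset M then
        M.N * (M.a v / M.RD + M.a v / M.RS) else 0)
      + if (v, w) ∈ M.E ∧ w ∈ Pset M then M.N * (M.a v / M.RD + M.a v / M.RS) else 0)
      = childCount M v * (M.N * (M.a v / M.RD + M.a v / M.RS)) := by
    rw [hcount, ← nsmul_eq_mul, ← Finset.sum_const, Finset.sum_filter]
    refine Finset.sum_congr rfl fun w _ => ?_
    by_cases hE : (v, w) ∈ M.E <;> by_cases hP : w ∈ Pset M <;> simp [hE, hP]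
  rw [← hchildren, Finset.sum_add_distrib]
  simp only [Fintype.sum_sum_type, Fintype.sum_bool, layerN, wG']
  by_cases hP : v ∈ Pset M <;> simp [hP, add_assoc]

/-- **Case-2 step in `G'` (generalizing Eq. (15)).** Let `p` have exactly
`m ≥ 2` children and let `u` be a child of `p` with `u ∉ P` having exactly one
child.  For the s-t cuts `C₁ = {D, p'}` and `C₂ = {D, p', p, u}` of `G'`,
`T_{G'}(C₂) − T_{G'}(C₁) = (m−2)·N·(a(p)/R_D + a(p)/R_S) + N·(ξ_D(u) − ξ_S(u))
+ N·(a(u)/R_D + a(u)/R_S) + k(u)/R_D + k(u)/R_S`;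
in particular, under Assumption 1, if `a(u) > 0` then `T_{G'}(C₂) > T_{G'}(C₁)`,
so `C₂` is not a minimum s-t cut of `G'`. -/
theorem case2_cut_in_Gprime {V : Type} [Fintype V] (M : SLModel V) (hM : M.Valid)
    (hAss1 : ∀ v, M.xiS v ≤ M.xiD v)
    (p u : V) (m : ℕ) (hm : 2 ≤ m) (hcp : childCount M p = m)
    (hpu : (p, u) ∈ M.E) (hunP : u ∉ Pset M) (hcu : childCount M u = 1) :
    cutValG' M ({srcN, auxN p, layerN p, layerN u} : Finset (V ⊕ V ⊕ Bool))
        - cutValG' M ({srcN, auxN p} : Finset (V ⊕ V ⊕ Bool))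
      = ((m : ℝ) - 2) * M.N * (M.a p / M.RD + M.a p / M.RS)
        + M.N * (M.xiD u - M.xiS u) + M.N * (M.a u / M.RD + M.a u / M.RS)
        + M.k u / M.RD + M.k u / M.RS
    ∧ (0 < M.a u →
        cutValG' M ({srcN, auxN p} : Finset (V ⊕ V ⊕ Bool))
            < cutValG' M ({srcN, auxN p, layerN p, layerN u} : Finset (V ⊕ V ⊕ Bool))
        ∧ ¬ ∀ C' : Finset (V ⊕ V ⊕ Bool), IsCutG' C' →
            cutValG' M ({srcN, auxN p, layerN p, layerN u} : Finset (V ⊕ V ⊕ Bool))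
              ≤ cutValG' M C') := by
  obtain ⟨hN, hRD, hRS, -, -, hk, ha, f, hf⟩ := hM
  have hP : p ∈ Pset M := by simp [Pset, hcp, hm]
  have hne : p ≠ u := fun h => hunP (h ▸ hP)
  have hloop (v : V) : (v, v) ∉ M.E := fun h => lt_irrefl _ (hf _ h)
  have hup : (u, p) ∉ M.E := fun h => lt_asymm (hf _ h) (hf _ hpu)
  have hstep₁ := cutValG'_insert M {srcN, auxN p} (layerN p)
    (by simp [layerN, srcN, auxN]) (by simp [layerN, wG', hloop])
  have hstep₂ := cutValG'_insert M (insert (layerN p) {srcN, auxN p}) (layerN u)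
    (by simp [layerN, srcN, auxN, hne.symm]) (by simp [layerN, wG', hloop])
  have hset : ({srcN, auxN p, layerN p, layerN u} : Finset (V ⊕ V ⊕ Bool))
      = insert (layerN u) (insert (layerN p) {srcN, auxN p}) := by
    ext x
    simp only [Finset.mem_insert, Finset.mem_singleton]
    tauto
  rw [sum_wG'_layerN, Finset.sum_pair (by simp [srcN, auxN])] at hstep₁
  rw [sum_wG'_layerN, Finset.sum_insert (by simp [layerN, srcN, auxN]),
    Finset.sum_pair (by simp [srcN, auxN])] at hstep₂
  simp only [hcp, hP, layerN, srcN, auxN, wG', hloop] at hstep₁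
  simp only [hcu, hunP, hpu, hup, hne, layerN, srcN, auxN, wG'] at hstep₂
  simp at hstep₁ hstep₂
  have hdiff : cutValG' M ({srcN, auxN p, layerN p, layerN u} : Finset (V ⊕ V ⊕ Bool))
        - cutValG' M ({srcN, auxN p} : Finset (V ⊕ V ⊕ Bool))
      = ((m : ℝ) - 2) * M.N * (M.a p / M.RD + M.a p / M.RS)
        + M.N * (M.xiD u - M.xiS u) + M.N * (M.a u / M.RD + M.a u / M.RS)
        + M.k u / M.RD + M.k u / M.RS := by
    rw [hset]
    simp only [layerN, srcN, auxN]
    rw [hstep₂, hstep₁]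
    ring
  refine ⟨hdiff, fun hau => ?_⟩
  have hlt : cutValG' M ({srcN, auxN p} : Finset (V ⊕ V ⊕ Bool))
      < cutValG' M ({srcN, auxN p, layerN p, layerN u} : Finset (V ⊕ V ⊕ Bool)) := by
    rw [← sub_pos, hdiff]
    have hm' : (0 : ℝ) ≤ m - 2 := sub_nonneg.2 (by exact_mod_cast hm)
    have hxi : 0 ≤ M.xiD u - M.xiS u := sub_nonneg.2 (hAss1 u)
    have hap := ha p
    have hku := hk u
    positivity
  exact ⟨hlt, fun hmin => hlt.not_ge (hmin _ (by simp [IsCutG', srcN, snkN, auxN]))⟩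
end

section
/- In the block setup, let V_D ⊆ V be a splitting with v_in ∈ V_D, set V_B = V_D ∩ B, and let V_D′ = V_D ∖ V_B (the splitting that assigns all of B to the server and agrees with V_D elsewhere). Let A = Σ_{v ∈ {v_in} ∪ V_B with some child in V ∖ V_D} a(v) (the total smashed-data size crossing from the device to the server in the block region under V_D). Then T(V_D) − T(V_D′) = N·(A − a(v_in))·(1/R_D + 1/R_S) + Σ_{v ∈ V_B} (k(v)/R_D + k(v)/R_S) + N·Σ_{v ∈ V_B} (ξ_D(v) − ξ_S(v)). (Identity (A.1) in the proof of Theorem 2.) -/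
open Finset

attribute [local instance] Classical.propDecidable

/-- The smashed data crossing a splitting, compared with the splitting that moves the whole
block to the server: only the input vertex and the device layers of the block matter. -/
theorem SLModel.sum_boundary_add_eq {V : Type} [Fintype V] (M : SLModel V) {B : Finset V} {vin : V}
    (hchB : ∀ u, (vin, u) ∈ M.E → u ∈ B) (hex : ∃ u, (vin, u) ∈ M.E)
    (hpar : ∀ v ∈ B, ∀ u, (u, v) ∈ M.E → u ∈ B ∨ u = vin) (hvin : vin ∉ B)
    {VD : Finset V} (hvd : vin ∈ VD) :
    ∑ v ∈ M.boundary VD, M.a v + M.a vin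
      = ∑ v ∈ (insert vin (VD ∩ B)).filter (fun v => ∃ u, (v, u) ∈ M.E ∧ u ∉ VD), M.a v
        + ∑ v ∈ M.boundary (VD \ (VD ∩ B)), M.a v := by
  have hmem : vin ∈ M.boundary (VD \ (VD ∩ B)) := by
    obtain ⟨u, hu⟩ := hex
    have := hchB u hu
    simp only [boundary, mem_filter]
    exact ⟨by grind, u, hu, by grind⟩
  have hsplit : M.boundary VD
      = (insert vin (VD ∩ B)).filter (fun v => ∃ u, (v, u) ∈ M.E ∧ u ∉ VD)
        ∪ (M.boundary (VD \ (VD ∩ B))).erase vin := by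
    ext v
    simp only [boundary, mem_filter, mem_union, mem_erase, mem_insert, mem_inter, mem_sdiff]
    grind
  have hdisj : Disjoint ((insert vin (VD ∩ B)).filter (fun v => ∃ u, (v, u) ∈ M.E ∧ u ∉ VD))
      ((M.boundary (VD \ (VD ∩ B))).erase vin) := by
    refine disjoint_left.2 fun v => ?_
    simp only [boundary, mem_filter, mem_erase, mem_insert, mem_inter, mem_sdiff]
    grind
  rw [hsplit, sum_union hdisj, add_assoc, sum_erase_add _ _ hmem]

/-- **Identity (A.1) in the proof of Theorem 2.** In the block setup
(`B` nonempty, input vertex `v_in ∉ B` with all children in `B` and at least one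
child, every parent of a vertex of `B` lying in `B ∪ {v_in}`), for any splitting
`V_D` with `v_in ∈ V_D`, setting `V_B = V_D ∩ B`, `V_D' = V_D ∖ V_B`, and
`A = Σ_{v ∈ {v_in} ∪ V_B having a child outside V_D} a(v)`:
`T(V_D) − T(V_D') = N·(A − a(v_in))·(1/R_D + 1/R_S)
+ Σ_{v ∈ V_B} (k(v)/R_D + k(v)/R_S) + N·Σ_{v ∈ V_B} (ξ_D(v) − ξ_S(v))`. -/
theorem block_delay_difference {V : Type} [Fintype V] (M : SLModel V) (hM : M.Valid)
    (B : Finset V) (hB : B.Nonempty) (vin : V) (hvin : vin ∉ B)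
    (hchB : ∀ u, (vin, u) ∈ M.E → u ∈ B) (hex : ∃ u, (vin, u) ∈ M.E)
    (hpar : ∀ v ∈ B, ∀ u, (u, v) ∈ M.E → u ∈ B ∨ u = vin)
    (VD : Finset V) (hvd : vin ∈ VD) :
    M.T VD - M.T (VD \ (VD ∩ B))
      = M.N * ((∑ v ∈ (insert vin (VD ∩ B)).filter
              (fun v => ∃ u, (v, u) ∈ M.E ∧ u ∉ VD), M.a v) - M.a vin)
            * (1 / M.RD + 1 / M.RS)
        + ∑ v ∈ VD ∩ B, (M.k v / M.RD + M.k v / M.RS)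
        + M.N * ∑ v ∈ VD ∩ B, (M.xiD v - M.xiS v) := by
  have hk := sum_sdiff (f := M.k) (inter_subset_left (s₁ := VD) (s₂ := B))
  have hxiD := sum_sdiff (f := M.xiD) (inter_subset_left (s₁ := VD) (s₂ := B))
  have hxiS : ∑ v ∈ univ \ (VD \ (VD ∩ B)), M.xiS v
      = ∑ v ∈ univ \ VD, M.xiS v + ∑ v ∈ VD ∩ B, M.xiS v := by
    rw [← sum_union (disjoint_left.2 (by grind))]
    congr 1
    grind
  have hcut := M.sum_boundary_add_eq hchB hex hpar hvin hvd
  simp only [SLModel.T, ← sum_div, sum_add_distrib, sum_sub_distrib, hxiS, ← hk, ← hxiD,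
    eq_sub_of_add_eq hcut]
  ring
end

section
/- In the block-abstraction setup, for every splitting V_D ⊆ V such that either B ⊆ V_D or B ∩ V_D = ∅, define the abstracted splitting V̄_D = (V_D ∖ B) ∪ {b} if B ⊆ V_D, and V̄_D = V_D if B ∩ V_D = ∅. Then the training delays agree: T(V_D) = T̄(V̄_D). (Correctness of the block-level abstraction used by the block-wise model splitting algorithm: abstracting a block into a single vertex with summed execution weights and summed output propagation weight preserves the training delay of every splitting that does not cut inside the block.) -/
open Finset

attribute [local instance] Classical.propDecidable

/-- Layer set of the abstracted model: `V̄ = (V ∖ B) ∪ {b}`, with `b = Sum.inr ()`. -/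
abbrev AbsV (V : Type) (B : Finset V) : Type := {v : V // v ∉ B} ⊕ Unit

/-- The abstracted model: edges of `E` between vertices of `V ∖ B`, an edge
`(u, b)` for each `u ∈ V ∖ B` having a child in `B`, and the edge `(b, z)`;
the block vertex `b` carries the summed execution delays and parameter sizes of
`B`, and its smashed-data size is the summed output `Σ_{v ∈ B, (v,z) ∈ E} a(v)`. -/
noncomputable def abstractModel {V : Type} [Fintype V] (M : SLModel V) (B : Finset V)
    (z : V) : SLModel (AbsV V B) where
  E := Finset.univ.filter (fun e =>
        match e with
        | (Sum.inl u, Sum.inl v) => (u.1, v.1) ∈ M.E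
        | (Sum.inl u, Sum.inr _) => ∃ w ∈ B, (u.1, w) ∈ M.E
        | (Sum.inr _, Sum.inl v) => v.1 = z
        | (Sum.inr _, Sum.inr _) => False)
  N := M.N
  RD := M.RD
  RS := M.RS
  xiD := fun x => match x with
    | Sum.inl u => M.xiD u.1
    | Sum.inr _ => ∑ v ∈ B, M.xiD v
  xiS := fun x => match x with
    | Sum.inl u => M.xiS u.1
    | Sum.inr _ => ∑ v ∈ B, M.xiS v
  k := fun x => match x with
    | Sum.inl u => M.k u.1
    | Sum.inr _ => ∑ v ∈ B, M.k v
  a := fun x => match x with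
    | Sum.inl u => M.a u.1
    | Sum.inr _ => ∑ v ∈ B.filter (fun v => (v, z) ∈ M.E), M.a v

/-- Abstracted splitting: `V̄_D = (V_D ∖ B) ∪ {b}` if `B ⊆ V_D`, and
`V̄_D = V_D` if `B ∩ V_D = ∅`. -/
noncomputable def abstractSplit {V : Type} [Fintype V] (B : Finset V) (VD : Finset V) :
    Finset (AbsV V B) :=
  Finset.univ.filter (fun x => match x with
    | Sum.inl u => u.1 ∈ VD
    | Sum.inr _ => B ⊆ VD)

/-- A sum over layers equals a sum over abstracted layers when the two index sets and summands
agree off the block and the block vertex carries the contribution of the block. -/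
theorem sum_eq_sum_absV {V : Type} [Fintype V] {B S : Finset V} {S' : Finset (AbsV V B)}
    {f : V → ℝ} {g : AbsV V B → ℝ} (hS : ∀ u, Sum.inl u ∈ S' ↔ u.1 ∈ S)
    (hf : ∀ u, g (Sum.inl u) = f u.1)
    (hb : ∑ v ∈ B with v ∈ S, f v = if Sum.inr () ∈ S' then g (Sum.inr ()) else 0) :
    ∑ v ∈ S, f v = ∑ x ∈ S', g x := by
  have hV : ∑ v ∈ S, f v = ∑ v, if v ∈ S then f v else 0 := by simp
  have hA : ∑ x ∈ S', g x = ∑ x, if x ∈ S' then g x else 0 := by simp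
  rw [hV, hA, Fintype.sum_sum_type, ← Finset.sum_add_sum_compl B, add_comm]
  congr 1
  · simp only [hS, hf]
    exact Finset.sum_subtype Bᶜ (by simp) fun v => if v ∈ S then f v else 0
  · simpa [Finset.sum_filter] using hb

theorem inl_mem_abstractSplit {V : Type} [Fintype V] {B VD : Finset V} (u : {v : V // v ∉ B}) :
    Sum.inl u ∈ abstractSplit B VD ↔ u.1 ∈ VD := by
  simp [abstractSplit]

theorem inr_mem_abstractSplit {V : Type} [Fintype V] {B VD : Finset V} :
    (Sum.inr () : AbsV V B) ∈ abstractSplit B VD ↔ B ⊆ VD := by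
  simp [abstractSplit]

theorem inl_mem_boundary_abstractModel {V : Type} [Fintype V] (M : SLModel V) {B VD : Finset V}
    (z : V) (hVD : B ⊆ VD ∨ Disjoint B VD) (u : {v : V // v ∉ B}) :
    Sum.inl u ∈ (abstractModel M B z).boundary (abstractSplit B VD) ↔ u.1 ∈ M.boundary VD := by
  simp only [SLModel.boundary, Finset.mem_filter, inl_mem_abstractSplit, Sum.exists,
    and_congr_right_iff]
  intro _
  constructor
  · rintro (⟨v, hv, hvD⟩ | ⟨_, hv, hvD⟩)
    · exact ⟨v, by simpa [abstractModel] using hv, by simpa [inl_mem_abstractSplit] using hvD⟩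
    · obtain ⟨w, hw, hE⟩ : ∃ w ∈ B, (u.1, w) ∈ M.E := by simpa [abstractModel] using hv
      have hBD := hVD.resolve_left fun h => hvD (inr_mem_abstractSplit.2 h)
      exact ⟨w, hE, Finset.disjoint_left.1 hBD hw⟩
  · rintro ⟨v, hv, hvD⟩
    by_cases hvB : v ∈ B
    · refine Or.inr ⟨(), ?_, fun h => hvD (inr_mem_abstractSplit.1 h hvB)⟩
      simpa [abstractModel] using ⟨v, hvB, hv⟩
    · exact Or.inl ⟨⟨v, hvB⟩, by simpa [abstractModel] using hv,
        by simpa [inl_mem_abstractSplit] using hvD⟩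

theorem inr_mem_boundary_abstractModel {V : Type} [Fintype V] (M : SLModel V) {B VD : Finset V}
    {z : V} (hz : z ∉ B) :
    Sum.inr () ∈ (abstractModel M B z).boundary (abstractSplit B VD) ↔ B ⊆ VD ∧ z ∉ VD := by
  simp [SLModel.boundary, inr_mem_abstractSplit, inl_mem_abstractSplit, abstractModel, hz]

theorem filter_mem_boundary {V : Type} (M : SLModel V) {B VD : Finset V} {z : V}
    (hout : ∀ u ∈ B, ∀ v, (u, v) ∈ M.E → v ∉ B → v = z) (hVD : B ⊆ VD ∨ Disjoint B VD) :
    {v ∈ B | v ∈ M.boundary VD} =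
      if B ⊆ VD ∧ z ∉ VD then {v ∈ B | (v, z) ∈ M.E} else ∅ := by
  ext v
  simp only [SLModel.boundary, Finset.mem_filter]
  split_ifs with h
  · obtain ⟨hBD, hzD⟩ := h
    rw [Finset.mem_filter]
    refine and_congr_right fun hv => ⟨?_, fun hE => ⟨hBD hv, z, hE, hzD⟩⟩
    rintro ⟨_, u, hE, hu⟩
    exact hout v hv u hE (fun h => hu (hBD h)) ▸ hE
  · simp only [Finset.notMem_empty, iff_false]
    rintro ⟨hv, hvD, u, hE, hu⟩
    have hBD := hVD.resolve_right fun hd => Finset.disjoint_left.1 hd hv hvD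
    exact h ⟨hBD, hout v hv u hE (fun h => hu (hBD h)) ▸ hu⟩

theorem sum_boundary_abstractModel {V : Type} [Fintype V] (M : SLModel V) {B VD : Finset V}
    {z : V} (hz : z ∉ B)
    (hout : ∀ u ∈ B, ∀ v, (u, v) ∈ M.E → v ∉ B → v = z) (hVD : B ⊆ VD ∨ Disjoint B VD) (r : ℝ) :
    ∑ v ∈ M.boundary VD, M.a v / r =
      ∑ x ∈ (abstractModel M B z).boundary (abstractSplit B VD), (abstractModel M B z).a x / r := by
  refine sum_eq_sum_absV (inl_mem_boundary_abstractModel M z hVD) (fun _ => rfl) ?_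
  simp only [inr_mem_boundary_abstractModel M hz, filter_mem_boundary M hout hVD]
  split_ifs
  · simp [abstractModel, Finset.sum_div]
  · simp

theorem sum_abstractSplit {V : Type} [Fintype V] {B VD : Finset V} (hB : B.Nonempty)
    (hVD : B ⊆ VD ∨ Disjoint B VD) {f : V → ℝ} {g : AbsV V B → ℝ}
    (hf : ∀ u, g (Sum.inl u) = f u.1) (hb : g (Sum.inr ()) = ∑ v ∈ B, f v) :
    ∑ v ∈ VD, f v = ∑ x ∈ abstractSplit B VD, g x := by
  refine sum_eq_sum_absV inl_mem_abstractSplit hf ?_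
  simp only [inr_mem_abstractSplit, hb]
  rcases hVD with h | h
  · rw [if_pos h, Finset.filter_true_of_mem fun v hv => h hv]
  · rw [if_neg fun h' => hB.ne_empty (Finset.disjoint_self_iff_empty B |>.1 (h.mono_right h')),
      Finset.filter_false_of_mem fun v hv => Finset.disjoint_left.1 h hv, Finset.sum_empty]

theorem sum_compl_abstractSplit {V : Type} [Fintype V] {B VD : Finset V} (hB : B.Nonempty)
    (hVD : B ⊆ VD ∨ Disjoint B VD) {f : V → ℝ} {g : AbsV V B → ℝ}
    (hf : ∀ u, g (Sum.inl u) = f u.1) (hb : g (Sum.inr ()) = ∑ v ∈ B, f v) :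
    ∑ v ∈ univ \ VD, f v = ∑ x ∈ univ \ abstractSplit B VD, g x := by
  refine sum_eq_sum_absV (by simp [inl_mem_abstractSplit]) hf ?_
  simp only [Finset.mem_sdiff, Finset.mem_univ, true_and, inr_mem_abstractSplit, hb]
  rcases hVD with h | h
  · rw [if_neg (not_not.2 h), Finset.filter_false_of_mem fun v hv => not_not.2 (h hv),
      Finset.sum_empty]
  · rw [if_pos fun h' => hB.ne_empty (Finset.disjoint_self_iff_empty B |>.1 (h.mono_right h')),
      Finset.filter_true_of_mem fun v hv => Finset.disjoint_left.1 h hv]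

/-- **Correctness of block-level abstraction.** If every edge of `E` from `B` to
`V ∖ B` ends at the single vertex `z`, then for every splitting `V_D` with
`B ⊆ V_D` or `B ∩ V_D = ∅`, the training delay of `V_D` in the original model
equals the training delay of the abstracted splitting in the abstracted model. -/
theorem block_abstraction_preserves_delay {V : Type} [Fintype V] (M : SLModel V)
    (hM : M.Valid) (B : Finset V) (hB : B.Nonempty) (z : V) (hz : z ∉ B)
    (hout : ∀ u ∈ B, ∀ v, (u, v) ∈ M.E → v ∉ B → v = z) :
    ∀ VD : Finset V, (B ⊆ VD ∨ B ∩ VD = ∅) →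
      M.T VD = (abstractModel M B z).T (abstractSplit B VD) := by
  intro VD h
  have hVD : B ⊆ VD ∨ Disjoint B VD := h.imp_right Finset.disjoint_iff_inter_eq_empty.2
  have hD := sum_abstractSplit hB hVD (f := M.xiD) (g := (abstractModel M B z).xiD)
    (fun _ => rfl) rfl
  have hS := sum_compl_abstractSplit hB hVD (f := M.xiS) (g := (abstractModel M B z).xiS)
    (fun _ => rfl) rfl
  have hk (r : ℝ) := sum_abstractSplit hB hVD (f := fun v => M.k v / r)
    (g := fun x => (abstractModel M B z).k x / r) (fun _ => rfl) (Finset.sum_div ..)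
  have ha := sum_boundary_abstractModel M hz hout hVD
  simp only [SLModel.T, hD, hS, hk, ha]
  congr!
end
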